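/- arXiv:2412.15044 — 2 statements merged into one kernel-verified Lean document; each statement's English description precedes it below -/
import Mathlib

section
/- Let μ be a centered probability measure on ℝⁿ with log-concave density f, and define L_μ = e^{-Ent(μ)/n} · (det cov(μ))^{1/(2n)}. Then L_μ ≤ f(0)^{1/n} · (det cov(μ))^{1/(2n)} ≤ e · L_μ. -/
open MeasureTheory

open Set Filter Topology

/-- A nonnegative function is log-concave when it is multiplicatively concave along segments. -/
def IsLogConcave {E : Type*} [AddCommGroup E] [Module ℝ E] (f : E → ℝ) : Prop :=
  ∀ x y : E, ∀ t : ℝ, 0 ≤ t → t ≤ 1 → f x ^ t * f y ^ (1 - t) ≤ f (t • x + (1 - t) • y)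

namespace IsLogConcave

section Algebra

variable {E : Type*} [AddCommGroup E] [Module ℝ E] {f : E → ℝ}

theorem comp_add_right (hlc : IsLogConcave f) (p : E) : IsLogConcave fun x => f (x + p) := by
  intro x y t h0 h1
  have h := hlc (x + p) (y + p) t h0 h1
  have e : t • (x + p) + (1 - t) • (y + p) = t • x + (1 - t) • y + p := by module
  rwa [e] at h

theorem concaveOn_log (hlc : IsLogConcave f) :
    ConcaveOn ℝ {x | 0 < f x} fun x => Real.log (f x) := by
  have key : ∀ x, 0 < f x → ∀ y, 0 < f y → ∀ a b : ℝ, 0 ≤ a → 0 ≤ b → a + b = 1 →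
      0 < f x ^ a * f y ^ b ∧ f x ^ a * f y ^ b ≤ f (a • x + b • y) := by
    intro x hx y hy a b ha hb hab
    obtain rfl : b = 1 - a := by linarith
    exact ⟨by positivity, hlc x y a ha (by linarith)⟩
  refine ⟨fun x hx y hy a b ha hb hab => ?_, fun x hx y hy a b ha hb hab => ?_⟩
  · obtain ⟨h1, h2⟩ := key x hx y hy a b ha hb hab
    exact h1.trans_le h2
  · obtain ⟨h1, h2⟩ := key x hx y hy a b ha hb hab
    have hx' : 0 < f x := hx
    have hy' : 0 < f y := hy
    have h3 := Real.log_le_log h1 h2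
    rw [Real.log_mul (by positivity) (by positivity), Real.log_rpow hx', Real.log_rpow hy'] at h3
    simpa only [smul_eq_mul] using h3

end Algebra

section Topology

variable {E : Type*} [NormedAddCommGroup E] [NormedSpace ℝ E] [FiniteDimensional ℝ E] {f : E → ℝ}

theorem exists_ball_le_of_mem_interior (hlc : IsLogConcave f) {p : E}
    (hp : p ∈ interior {x | 0 < f x}) :
    ∃ r > 0, ∃ c > 0, ∀ x ∈ Metric.ball p r, c ≤ f x := by
  have hcont := hlc.concaveOn_log.continuousOn_interior.continuousAt
    (isOpen_interior.mem_nhds hp)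
  have hev : ∀ᶠ x in 𝓝 p, Real.exp (Real.log (f p) - 1) ≤ f x := by
    filter_upwards [hcont.eventually (lt_mem_nhds (sub_one_lt (Real.log (f p)))),
      isOpen_interior.mem_nhds hp] with x hx hxi
    have hfx : 0 < f x := interior_subset (s := {x | 0 < f x}) hxi
    exact ((Real.lt_log_iff_exp_lt hfx).1 hx).le
  obtain ⟨r, hr, h⟩ := Metric.eventually_nhds_iff_ball.1 hev
  exact ⟨r, hr, _, Real.exp_pos _, h⟩

end Topology

variable {E : Type*} [NormedAddCommGroup E] [NormedSpace ℝ E] [FiniteDimensional ℝ E]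
  [MeasurableSpace E] [BorelSpace E] {μ : Measure E} [μ.IsAddHaarMeasure] {f : E → ℝ}

theorem ae_mem_interior_support (hlc : IsLogConcave f) :
    ∀ᵐ x ∂μ, 0 < f x → x ∈ interior {x | 0 < f x} := by
  have h := hlc.concaveOn_log.1.addHaar_frontier μ
  filter_upwards [measure_eq_zero_iff_ae_notMem.1 h] with x hx hfx
  by_contra hxi
  exact hx ⟨subset_closure hfx, hxi⟩

theorem exists_ball_le (hlc : IsLogConcave f) (hnn : ∀ x, 0 ≤ f x) (hI : ∫ x, f x ∂μ ≠ 0) :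
    ∃ p : E, ∃ r > 0, ∃ c > 0, ∀ x ∈ Metric.ball p r, c ≤ f x := by
  obtain ⟨p, hp⟩ : (interior {x | 0 < f x}).Nonempty := by
    by_contra hne
    rw [not_nonempty_iff_eq_empty] at hne
    refine hI (integral_eq_zero_of_ae ?_)
    filter_upwards [hlc.ae_mem_interior_support (μ := μ)] with x hx
    by_contra hfx
    have := hx (lt_of_le_of_ne (hnn x) (Ne.symm hfx))
    rw [hne] at this
    exact this
  exact ⟨p, hlc.exists_ball_le_of_mem_interior hp⟩

theorem sqrt_mul_le_setIntegral (hlc : IsLogConcave f) (hnn : ∀ x, 0 ≤ f x)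
    (hint : Integrable f μ) {r c : ℝ} (hc : 0 < c)
    (hball : ∀ x ∈ Metric.ball (0 : E) r, c ≤ f x) (x : E) :
    f x ^ (1 / 2 : ℝ) * c ^ (1 / 2 : ℝ) * μ.real (Metric.ball 0 (r / 2)) ≤
      ∫ y in Metric.ball ((1 / 2 : ℝ) • x) (r / 2), f y ∂μ := by
  have hvol : μ.real (Metric.ball ((1 / 2 : ℝ) • x) (r / 2)) = μ.real (Metric.ball 0 (r / 2)) := by
    simp only [measureReal_def, Measure.addHaar_ball_center μ ((1 / 2 : ℝ) • x)]
  rw [← hvol]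
  refine setIntegral_ge_of_const_le_real measurableSet_ball measure_ball_lt_top.ne
    (fun z hz => ?_) hint.integrableOn
  have hy : (2 : ℝ) • z - x ∈ Metric.ball (0 : E) r := by
    rw [mem_ball_iff_norm] at hz
    have e : (2 : ℝ) • z - x = (2 : ℝ) • (z - (1 / 2 : ℝ) • x) := by module
    rw [mem_ball_zero_iff, e, norm_smul, Real.norm_ofNat]
    linarith
  have h := hlc x ((2 : ℝ) • z - x) (1 / 2) (by norm_num) (by norm_num)
  have e : (1 / 2 : ℝ) • x + (1 - 1 / 2 : ℝ) • ((2 : ℝ) • z - x) = z := by module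
  rw [e] at h
  refine le_trans ?_ h
  rw [show (1 - 1 / 2 : ℝ) = 1 / 2 by norm_num]
  have := hball _ hy
  have := Real.rpow_nonneg (hnn x) (1 / 2)
  gcongr

theorem exists_forall_le (hlc : IsLogConcave f) (hnn : ∀ x, 0 ≤ f x)
    (hint : Integrable f μ) {r c : ℝ} (hr : 0 < r) (hc : 0 < c)
    (hball : ∀ x ∈ Metric.ball (0 : E) r, c ≤ f x) : ∃ B, ∀ x, f x ^ (1 / 2 : ℝ) ≤ B := by
  have hv : 0 < μ.real (Metric.ball (0 : E) (r / 2)) :=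
    ENNReal.toReal_pos (Metric.measure_ball_pos μ 0 (by positivity)).ne' measure_ball_lt_top.ne
  refine ⟨(∫ y, f y ∂μ) / (c ^ (1 / 2 : ℝ) * μ.real (Metric.ball (0 : E) (r / 2))), fun x => ?_⟩
  rw [le_div_iff₀ (by positivity), ← mul_assoc]
  exact (hlc.sqrt_mul_le_setIntegral hnn hint hc hball x).trans
    (setIntegral_le_integral hint (ae_of_all _ hnn))

theorem exists_forall_norm_le (hlc : IsLogConcave f) (hnn : ∀ x, 0 ≤ f x)
    (hint : Integrable f μ) {r c ε : ℝ} (hr : 0 < r) (hc : 0 < c) (hε : 0 < ε)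
    (hball : ∀ x ∈ Metric.ball (0 : E) r, c ≤ f x) :
    ∃ R > 0, ∀ x, R ≤ ‖x‖ → f x ^ (1 / 2 : ℝ) ≤ ε := by
  have hv : 0 < μ.real (Metric.ball (0 : E) (r / 2)) :=
    ENNReal.toReal_pos (Metric.measure_ball_pos μ 0 (by positivity)).ne' measure_ball_lt_top.ne
  have htend := tendsto_setIntegral_of_antitone (μ := μ) (f := f)
    (s := fun k : ℕ => (Metric.ball (0 : E) k)ᶜ) (fun k => measurableSet_ball.compl)
    (fun a b hab => compl_subset_compl.2 (Metric.ball_subset_ball (by exact_mod_cast hab)))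
    ⟨0, hint.integrableOn⟩
  have hempty : (⋂ k : ℕ, (Metric.ball (0 : E) k)ᶜ) = ∅ := by
    rw [← compl_iUnion, Metric.iUnion_ball_nat, compl_univ]
  rw [hempty, setIntegral_empty] at htend
  have hδ : 0 < ε * (c ^ (1 / 2 : ℝ) * μ.real (Metric.ball (0 : E) (r / 2))) := by positivity
  obtain ⟨k, hk⟩ := (htend.eventually (gt_mem_nhds hδ)).exists
  refine ⟨2 * k + r, by positivity, fun x hx => ?_⟩
  have hsub : Metric.ball ((1 / 2 : ℝ) • x) (r / 2) ⊆ (Metric.ball (0 : E) k)ᶜ := by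
    intro z hz hzk
    rw [mem_ball_iff_norm'] at hz
    rw [mem_ball_zero_iff] at hzk
    have h1 : ‖(1 / 2 : ℝ) • x‖ ≤ ‖(1 / 2 : ℝ) • x - z‖ + ‖z‖ := by
      simpa using norm_add_le ((1 / 2 : ℝ) • x - z) z
    rw [norm_smul, Real.norm_of_nonneg (by norm_num)] at h1
    linarith
  have h1 := hlc.sqrt_mul_le_setIntegral hnn hint hc hball x
  have h2 : ∫ y in Metric.ball ((1 / 2 : ℝ) • x) (r / 2), f y ∂μ ≤
      ∫ y in (Metric.ball (0 : E) k)ᶜ, f y ∂μ :=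
    setIntegral_mono_set hint.integrableOn (ae_of_all _ hnn) hsub.eventuallyLE
  rw [mul_assoc] at h1
  exact (lt_of_mul_lt_mul_right ((h1.trans h2).trans_lt hk) (by positivity)).le

theorem exists_norm_sq_mul_sqrt_le (hlc : IsLogConcave f) (hnn : ∀ x, 0 ≤ f x)
    (hint : Integrable f μ) {r c : ℝ} (hr : 0 < r) (hc : 0 < c)
    (hball : ∀ x ∈ Metric.ball (0 : E) r, c ≤ f x) :
    ∃ C, ∀ x, ‖x‖ ^ 2 * f x ^ (1 / 2 : ℝ) ≤ C := by
  obtain ⟨B, hB⟩ := hlc.exists_forall_le hnn hint hr hc hball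
  obtain ⟨R, hR, hdecay⟩ := hlc.exists_forall_norm_le hnn hint hr hc
    (Real.exp_pos (Real.log c / 2 - 1)) hball
  refine ⟨max (R ^ 2 * B) (2 * R ^ 2 * Real.exp (Real.log c / 2)), fun x => ?_⟩
  have hs := Real.rpow_nonneg (hnn x) (1 / 2)
  rcases le_total ‖x‖ R with hx | hx
  · refine le_max_of_le_left ?_
    have := hB x
    gcongr
  refine le_max_of_le_right ?_
  rcases (hnn x).eq_or_lt with h0 | hpos
  · rw [← h0, Real.zero_rpow (by norm_num), mul_zero]
    positivity
  have hxp : 0 < ‖x‖ := hR.trans_le hx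
  have ht0 : 0 < R / ‖x‖ := by positivity
  have ht1 : R / ‖x‖ ≤ 1 := (div_le_one hxp).2 hx
  have hf0 : c ≤ f 0 := hball 0 (Metric.mem_ball_self hr)
  have hlogf0 := Real.log_le_log hc hf0
  have hconc := hlc x 0 (R / ‖x‖) ht0.le ht1
  rw [smul_zero, add_zero] at hconc
  have hf0pos : 0 < f 0 := hc.trans_le hf0
  have hlhs : 0 < f x ^ (R / ‖x‖) * f 0 ^ (1 - R / ‖x‖) := by positivity
  have hz := hlhs.trans_le hconc
  have hlog := Real.log_le_log hlhs hconc
  rw [Real.log_mul (by positivity) (by positivity), Real.log_rpow hpos,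
    Real.log_rpow hf0pos] at hlog
  have hzdec := hdecay ((R / ‖x‖) • x) (by
    rw [norm_smul, Real.norm_of_nonneg ht0.le, div_mul_cancel₀ _ hxp.ne'])
  have hzlog := Real.log_le_log (by positivity) hzdec
  rw [Real.log_rpow hz, Real.log_exp] at hzlog
  have h1 : R / ‖x‖ * (Real.log (f x) - Real.log c) ≤ -2 := by
    have := mul_le_mul_of_nonneg_left hlogf0 (sub_nonneg.2 ht1)
    linarith
  have h2 : Real.log (f x) ≤ Real.log c - 2 * (‖x‖ / R) := by
    have h3 := mul_le_mul_of_nonneg_left h1 (by positivity : 0 ≤ ‖x‖ / R)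
    rw [← mul_assoc, div_mul_div_cancel₀ hR.ne', div_self hxp.ne'] at h3
    linarith
  have h4 : f x ^ (1 / 2 : ℝ) ≤ Real.exp (Real.log c / 2) * (Real.exp (‖x‖ / R))⁻¹ := by
    rw [Real.rpow_def_of_pos hpos, ← Real.exp_neg, ← Real.exp_add]
    exact Real.exp_le_exp.2 (by linarith)
  have h5 : ‖x‖ ^ 2 ≤ 2 * R ^ 2 * Real.exp (‖x‖ / R) := by
    have h := Real.quadratic_le_exp_of_nonneg (by positivity : 0 ≤ ‖x‖ / R)
    have h' : (‖x‖ / R) ^ 2 / 2 ≤ Real.exp (‖x‖ / R) := by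
      have : 0 ≤ ‖x‖ / R := by positivity
      linarith
    rw [div_pow, div_div, div_le_iff₀ (by positivity)] at h'
    linarith
  calc ‖x‖ ^ 2 * f x ^ (1 / 2 : ℝ)
      ≤ 2 * R ^ 2 * Real.exp (‖x‖ / R) *
        (Real.exp (Real.log c / 2) * (Real.exp (‖x‖ / R))⁻¹) := by gcongr
    _ = 2 * R ^ 2 * Real.exp (Real.log c / 2) := by
        have := (Real.exp_pos (‖x‖ / R)).ne'
        field_simp

theorem integrable_rpow (hlc : IsLogConcave f) (hmeas : Measurable f) (hnn : ∀ x, 0 ≤ f x)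
    (hint : Integrable f μ) (hf0 : 0 < f 0) {t : ℝ} (ht0 : 0 < t) (ht1 : t ≤ 1) :
    Integrable (fun x => f x ^ t) μ := by
  have hdom : Integrable (fun x => (f 0 ^ (1 - t))⁻¹ * f (t • x)) μ :=
    (hint.comp_smul ht0.ne').const_mul _
  refine hdom.mono' (hmeas.pow_const t).aestronglyMeasurable (ae_of_all _ fun x => ?_)
  rw [Real.norm_of_nonneg (Real.rpow_nonneg (hnn x) t), le_inv_mul_iff₀ (by positivity), mul_comm]
  simpa using hlc x 0 t ht0.le ht1

theorem integral_rpow_mul_le (hlc : IsLogConcave f) (hmeas : Measurable f) (hnn : ∀ x, 0 ≤ f x)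
    (hint : Integrable f μ) (hf0 : 0 < f 0) {t : ℝ} (ht0 : 0 < t) (ht1 : t ≤ 1) :
    ∫ x, f x ^ t * f 0 ^ (1 - t) ∂μ ≤ (t ^ Module.finrank ℝ E)⁻¹ * ∫ x, f x ∂μ := by
  have h : ∫ x, f x ^ t * f 0 ^ (1 - t) ∂μ ≤ ∫ x, f (t • x) ∂μ :=
    integral_mono ((hlc.integrable_rpow hmeas hnn hint hf0 ht0 ht1).mul_const _)
      (hint.comp_smul ht0.ne') fun x => by simpa using hlc x 0 t ht0.le ht1
  rwa [Measure.integral_comp_smul, smul_eq_mul, abs_of_pos (by positivity)] at h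

theorem integrable_norm_sq_mul_of_ball (hlc : IsLogConcave f) (hmeas : Measurable f)
    (hnn : ∀ x, 0 ≤ f x) (hint : Integrable f μ) {r c : ℝ} (hr : 0 < r) (hc : 0 < c)
    (hball : ∀ x ∈ Metric.ball (0 : E) r, c ≤ f x) :
    Integrable (fun x => ‖x‖ ^ 2 * f x) μ := by
  obtain ⟨C, hC⟩ := hlc.exists_norm_sq_mul_sqrt_le hnn hint hr hc hball
  have hf0 : 0 < f 0 := hc.trans_le (hball 0 (Metric.mem_ball_self hr))
  refine ((hlc.integrable_rpow hmeas hnn hint hf0 one_half_pos one_half_lt_one.le).const_mul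
    C).mono' (by fun_prop) (ae_of_all _ fun x => ?_)
  have hs := Real.rpow_nonneg (hnn x) (1 / 2)
  have hsq : f x = f x ^ (1 / 2 : ℝ) * f x ^ (1 / 2 : ℝ) := by
    rw [← Real.sqrt_eq_rpow, Real.mul_self_sqrt (hnn x)]
  rw [Real.norm_of_nonneg (mul_nonneg (by positivity) (hnn x))]
  calc ‖x‖ ^ 2 * f x = ‖x‖ ^ 2 * f x ^ (1 / 2 : ℝ) * f x ^ (1 / 2 : ℝ) := by
        rw [mul_assoc, ← hsq]
    _ ≤ C * f x ^ (1 / 2 : ℝ) := mul_le_mul_of_nonneg_right (hC x) hs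

theorem integrable_norm_sq_mul (hlc : IsLogConcave f) (hmeas : Measurable f)
    (hnn : ∀ x, 0 ≤ f x) (hint : Integrable f μ) : Integrable (fun x => ‖x‖ ^ 2 * f x) μ := by
  by_cases hI : ∫ x, f x ∂μ = 0
  · rw [integral_eq_zero_iff_of_nonneg hnn hint] at hI
    refine (integrable_zero E ℝ μ).congr ?_
    filter_upwards [hI] with x hx
    simp [hx]
  obtain ⟨p, r, hr, c, hc, hball⟩ := hlc.exists_ball_le hnn hI
  have h := ((hlc.comp_add_right p).integrable_norm_sq_mul_of_ball (by fun_prop)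
    (fun x => hnn _) (hint.comp_add_right p) hr hc fun x hx =>
      hball _ (by simpa [mem_ball_iff_norm] using hx)).comp_sub_right p
  simp only [sub_add_cancel] at h
  refine ((h.const_mul 2).add (hint.const_mul (2 * ‖p‖ ^ 2))).mono' (by fun_prop)
    (ae_of_all _ fun x => ?_)
  rw [Real.norm_of_nonneg (mul_nonneg (by positivity) (hnn x))]
  have h1 : ‖x‖ ≤ ‖x - p‖ + ‖p‖ := by simpa using norm_add_le (x - p) p
  have h2 : ‖x‖ ^ 2 ≤ 2 * ‖x - p‖ ^ 2 + 2 * ‖p‖ ^ 2 := by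
    nlinarith [sq_nonneg (‖x - p‖ - ‖p‖), norm_nonneg x]
  have h3 := mul_le_mul_of_nonneg_right h2 (hnn x)
  simp only [Pi.add_apply]
  linarith

theorem integrable_smul_id (hlc : IsLogConcave f) (hmeas : Measurable f)
    (hnn : ∀ x, 0 ≤ f x) (hint : Integrable f μ) : Integrable (fun x => f x • x) μ := by
  refine (hint.add (hlc.integrable_norm_sq_mul hmeas hnn hint)).mono' (by fun_prop)
    (ae_of_all _ fun x => ?_)
  rw [norm_smul, Real.norm_of_nonneg (hnn x)]
  simp only [Pi.add_apply]
  nlinarith [mul_nonneg (hnn x) (sq_nonneg (‖x‖ - 1)), mul_nonneg (hnn x) (sq_nonneg ‖x‖),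
    mul_nonneg (hnn x) (norm_nonneg x)]

theorem zero_mem_interior_support (hlc : IsLogConcave f) (hmeas : Measurable f)
    (hnn : ∀ x, 0 ≤ f x) (hint : Integrable f μ) (hI : ∫ x, f x ∂μ ≠ 0)
    (hcent : ∫ x, f x • x ∂μ = 0) : (0 : E) ∈ interior {x | 0 < f x} := by
  by_contra h0
  obtain ⟨l, hl⟩ := geometric_hahn_banach_open_point hlc.concaveOn_log.1.interior isOpen_interior h0
  have hid := hlc.integrable_smul_id hmeas hnn hint
  have hae := hlc.ae_mem_interior_support (μ := μ)
  have hl0 : ∫ x, -(f x * l x) ∂μ = 0 := by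
    have := l.integral_comp_comm hid
    simp only [map_smul, smul_eq_mul, hcent, map_zero] at this
    rw [integral_neg, this, neg_zero]
  have hli : Integrable (fun x => -(f x * l x)) μ := by
    have := l.integrable_comp hid
    simp only [map_smul, smul_eq_mul] at this
    exact this.neg
  have hlt : ∀ᵐ x ∂μ, 0 < f x → l x < 0 := by
    filter_upwards [hae] with x hx hfx
    simpa using hl x (hx hfx)
  have hlnn : 0 ≤ᵐ[μ] fun x => -(f x * l x) := by
    filter_upwards [hlt] with x hx
    rcases (hnn x).eq_or_lt with h | h
    · simp [← h]
    · simpa using mul_nonpos_of_nonneg_of_nonpos h.le (hx h).le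
  rw [integral_eq_zero_iff_of_nonneg_ae hlnn hli] at hl0
  refine hI (integral_eq_zero_of_ae ?_)
  filter_upwards [hl0, hlt] with x h1 h2
  rcases (hnn x).eq_or_lt with h | h
  · exact h.symm
  · have := mul_neg_of_pos_of_neg h (h2 h)
    simp only [Pi.zero_apply] at h1
    linarith

theorem integrable_mul_log (hlc : IsLogConcave f) (hmeas : Measurable f)
    (hnn : ∀ x, 0 ≤ f x) (hint : Integrable f μ) (h0 : (0 : E) ∈ interior {x | 0 < f x}) :
    Integrable (fun x => f x * Real.log (f x)) μ := by
  have hf0 : 0 < f 0 := interior_subset (s := {x | 0 < f x}) h0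
  obtain ⟨r, hr, c, hc, hball⟩ := hlc.exists_ball_le_of_mem_interior h0
  obtain ⟨B, hB⟩ := hlc.exists_forall_le hnn hint hr hc hball
  refine (((hlc.integrable_rpow hmeas hnn hint hf0 one_half_pos one_half_lt_one.le).const_mul
    2).add (hint.const_mul (2 * B))).mono' (by fun_prop) (ae_of_all _ fun x => ?_)
  rcases (hnn x).eq_or_lt with h | h
  · simp [← h]
  set s := f x ^ (1 / 2 : ℝ) with hs
  have hspos : 0 < s := by positivity
  have hsq : f x = s * s := by
    rw [hs, ← Real.sqrt_eq_rpow, Real.mul_self_sqrt (hnn x)]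
  have hlog : Real.log (f x) = 2 * Real.log s := by
    rw [hs, Real.log_rpow h]; ring
  have h1 := Real.log_le_sub_one_of_pos hspos
  have h2 := Real.one_sub_inv_le_log_of_pos hspos
  have h3 : s * (1 - s⁻¹) = s - 1 := by field_simp
  have hsB := hB x
  rw [← hs] at hsB
  simp only [Pi.add_apply, Real.norm_eq_abs, hlog, ← hs]
  rw [hsq, abs_le]
  have h4 : s * s - s ≤ s * s * Real.log s := by
    have := mul_le_mul_of_nonneg_left h2 (mul_self_nonneg s)
    rw [mul_assoc, h3] at this
    linarith
  have h5 : s * s * Real.log s ≤ s * s * B :=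
    mul_le_mul_of_nonneg_left (by linarith) (mul_self_nonneg s)
  have h6 : 0 ≤ s * s * B := mul_nonneg (mul_self_nonneg s) (hspos.le.trans hsB)
  constructor <;> nlinarith [mul_self_nonneg s]

theorem integral_mul_log_le (hlc : IsLogConcave f) (hmeas : Measurable f)
    (hnn : ∀ x, 0 ≤ f x) (hint : Integrable f μ) (hI : ∫ x, f x ∂μ = 1)
    (hcent : ∫ x, f x • x ∂μ = 0) : ∫ x, f x * Real.log (f x) ∂μ ≤ Real.log (f 0) := by
  have h0 := hlc.zero_mem_interior_support hmeas hnn hint (by simp [hI]) hcent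
  have hflog := hlc.integrable_mul_log hmeas hnn hint h0
  have hid := hlc.integrable_smul_id hmeas hnn hint
  set ν := μ.withDensity fun x => ENNReal.ofReal (f x) with hν
  have hdm : Measurable fun x => ENNReal.ofReal (f x) := hmeas.ennreal_ofReal
  have hdt : ∀ᵐ x ∂μ, ENNReal.ofReal (f x) < ⊤ := ae_of_all _ fun x => ENNReal.ofReal_lt_top
  have hprob : IsProbabilityMeasure ν := ⟨by
    rw [hν, withDensity_apply _ MeasurableSet.univ, Measure.restrict_univ,
      ← ofReal_integral_eq_lintegral_ofReal hint (ae_of_all _ hnn), hI, ENNReal.ofReal_one]⟩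
  have hidν : Integrable (fun x => x) ν := by
    rw [hν, integrable_withDensity_iff_integrable_smul' hdm hdt]
    simpa only [ENNReal.toReal_ofReal (hnn _)] using hid
  have hlogν : Integrable (fun x => Real.log (f x)) ν := by
    rw [hν, integrable_withDensity_iff_integrable_smul' hdm hdt]
    simpa only [ENNReal.toReal_ofReal (hnn _), smul_eq_mul] using hflog
  have hmean : ∫ x, x ∂ν = 0 := by
    rw [hν, integral_withDensity_eq_integral_toReal_smul hdm hdt]
    simpa only [ENNReal.toReal_ofReal (hnn _)] using hcent
  have hent : ∫ x, Real.log (f x) ∂ν = ∫ x, f x * Real.log (f x) ∂μ := by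
    rw [hν, integral_withDensity_eq_integral_toReal_smul hdm hdt]
    simp only [ENNReal.toReal_ofReal (hnn _), smul_eq_mul]
  have hsupp : ∀ᵐ x ∂ν, 0 < f x := by
    rw [hν, ae_withDensity_iff hdm]
    refine ae_of_all _ fun x hx => ?_
    by_contra hle
    exact hx (ENNReal.ofReal_of_nonpos (not_lt.1 hle))
  have hmem := hlc.concaveOn_log.convex_hypograph.closure.integral_mem (μ := ν)
    (f := fun x => (x, Real.log (f x))) isClosed_closure
    (by filter_upwards [hsupp] with x hx using subset_closure ⟨hx, le_rfl⟩)
    (hidν.prodMk hlogν)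
  rw [integral_pair hidν hlogν, hmean, hent] at hmem
  obtain ⟨u, hu, hlim⟩ := mem_closure_iff_seq_limit.1 hmem
  have hcont := hlc.concaveOn_log.continuousOn_interior.continuousAt
    (isOpen_interior.mem_nhds h0)
  have h1 : Tendsto (fun k => (u k).1) atTop (𝓝 0) := (continuous_fst.tendsto _).comp hlim
  have h2 : Tendsto (fun k => (u k).2) atTop (𝓝 (∫ x, f x * Real.log (f x) ∂μ)) :=
    (continuous_snd.tendsto _).comp hlim
  exact le_of_tendsto_of_tendsto' h2 (hcont.tendsto.comp h1) fun k => (hu k).2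

theorem log_sub_finrank_le_integral_mul_log (hlc : IsLogConcave f) (hmeas : Measurable f)
    (hnn : ∀ x, 0 ≤ f x) (hint : Integrable f μ) (hI : ∫ x, f x ∂μ = 1)
    (h0 : (0 : E) ∈ interior {x | 0 < f x}) :
    Real.log (f 0) - Module.finrank ℝ E ≤ ∫ x, f x * Real.log (f x) ∂μ := by
  have hf0 : 0 < f 0 := interior_subset (s := {x | 0 < f x}) h0
  have hflog := hlc.integrable_mul_log hmeas hnn hint h0
  set H := ∫ x, f x * Real.log (f x) ∂μ with hH
  set D := Real.log (f 0) - H with hD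
  have key : ∀ t : ℝ, 0 < t → t < 1 → t * D ≤ Module.finrank ℝ E := by
    intro t ht0 ht1
    set m := (1 - t) * D with hm
    have hpt : ∀ x, Real.exp m * ((1 + (1 - t) * Real.log (f 0) - m) * f x -
        (1 - t) * (f x * Real.log (f x))) ≤ f x ^ t * f 0 ^ (1 - t) := by
      intro x
      rcases (hnn x).eq_or_lt with h | h
      · simp [← h, Real.zero_rpow ht0.ne']
      have e1 : f x ^ t * f 0 ^ (1 - t) = Real.exp m * (f x *
          Real.exp ((1 - t) * (Real.log (f 0) - Real.log (f x)) - m)) := by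
        conv_rhs => enter [2, 1]; rw [← Real.exp_log h]
        rw [Real.rpow_def_of_pos h, Real.rpow_def_of_pos hf0, ← Real.exp_add, ← Real.exp_add,
          ← Real.exp_add]
        congr 1
        ring
      rw [e1]
      have h2 := mul_le_mul_of_nonneg_left
        (Real.add_one_le_exp ((1 - t) * (Real.log (f 0) - Real.log (f x)) - m)) h.le
      refine mul_le_mul_of_nonneg_left (le_trans (le_of_eq ?_) h2) (Real.exp_pos m).le
      ring
    have hle := integral_mono
      (((hint.const_mul (1 + (1 - t) * Real.log (f 0) - m)).sub (hflog.const_mul (1 - t))).const_mul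
        (Real.exp m))
      ((hlc.integrable_rpow hmeas hnn hint hf0 ht0 ht1.le).mul_const (f 0 ^ (1 - t))) hpt
    simp only [Pi.sub_apply] at hle
    rw [integral_const_mul, integral_sub (hint.const_mul _) (hflog.const_mul _),
      integral_const_mul, integral_const_mul, hI, ← hH] at hle
    have e : (1 + (1 - t) * Real.log (f 0) - m) * 1 - (1 - t) * H = 1 := by
      rw [hm, hD]; ring
    rw [e, mul_one] at hle
    have hle2 := hle.trans (hlc.integral_rpow_mul_le hmeas hnn hint hf0 ht0 ht1.le)
    rw [hI, mul_one, ← Real.le_log_iff_exp_le (by positivity), Real.log_inv, Real.log_pow] at hle2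
    have hlt := Real.one_sub_inv_le_log_of_pos ht0
    have h3 : (1 - t) * D ≤ Module.finrank ℝ E * (t⁻¹ - 1) := by
      have := mul_le_mul_of_nonneg_left hlt (Nat.cast_nonneg (α := ℝ) (Module.finrank ℝ E))
      linarith
    have h4 : t * ((1 - t) * D) ≤ Module.finrank ℝ E * (1 - t) := by
      calc t * ((1 - t) * D) ≤ t * (Module.finrank ℝ E * (t⁻¹ - 1)) :=
            mul_le_mul_of_nonneg_left h3 ht0.le
        _ = Module.finrank ℝ E * (1 - t) := by field_simp
    exact le_of_mul_le_mul_right (by linarith : t * D * (1 - t) ≤ _) (sub_pos.2 ht1)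
  have hlim : Tendsto (fun t : ℝ => t * D) (𝓝[<] 1) (𝓝 (1 * D)) :=
    ((continuous_mul_const D).tendsto 1).mono_left nhdsWithin_le_nhds
  have hDle : 1 * D ≤ Module.finrank ℝ E := by
    refine le_of_tendsto hlim ?_
    filter_upwards [Ioo_mem_nhdsLT one_pos] with t ht using key t ht.1 ht.2
  linarith

end IsLogConcave

theorem posSemidef_secondMoment {ι : Type*} [Fintype ι] {f : EuclideanSpace ℝ ι → ℝ}
    (hmeas : Measurable f) (hnn : ∀ x, 0 ≤ f x) (hint : Integrable fun x => ‖x‖ ^ 2 * f x) :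
    (Matrix.of fun i j => ∫ x : EuclideanSpace ℝ ι, f x * (x i * x j)).PosSemidef := by
  have hij : ∀ i j, Integrable fun x : EuclideanSpace ℝ ι => f x * (x i * x j) := by
    intro i j
    refine hint.mono' (by fun_prop) (ae_of_all _ fun x => ?_)
    rw [norm_mul, norm_mul, Real.norm_of_nonneg (hnn x), mul_comm, sq]
    exact mul_le_mul_of_nonneg_right (mul_le_mul (PiLp.norm_apply_le x i)
      (PiLp.norm_apply_le x j) (norm_nonneg _) (norm_nonneg _)) (hnn x)
  refine Matrix.PosSemidef.of_dotProduct_mulVec_nonneg ?_ fun v => ?_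
  · ext i j
    simp [mul_comm]
  · have e : star v ⬝ᵥ (Matrix.of fun i j => ∫ x : EuclideanSpace ℝ ι, f x * (x i * x j)).mulVec v =
        ∫ x : EuclideanSpace ℝ ι, f x * (∑ i, v i * x i) ^ 2 := by
      have e1 : ∀ x : EuclideanSpace ℝ ι, f x * (∑ i, v i * x i) ^ 2 =
          ∑ i, ∑ j, v i * v j * (f x * (x i * x j)) := by
        intro x
        rw [sq, Finset.sum_mul_sum, Finset.mul_sum]
        refine Finset.sum_congr rfl fun i _ => ?_
        rw [Finset.mul_sum]
        exact Finset.sum_congr rfl fun j _ => by ring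
      simp only [e1]
      rw [integral_finsetSum _ fun i _ => integrable_finsetSum _ fun j _ => (hij i j).const_mul _]
      simp only [dotProduct, Matrix.mulVec, Matrix.of_apply, star_trivial, Finset.mul_sum]
      refine Finset.sum_congr rfl fun i _ => ?_
      rw [integral_finsetSum _ fun j _ => (hij i j).const_mul _]
      refine Finset.sum_congr rfl fun j _ => ?_
      rw [integral_const_mul]
      ring
    rw [e]
    exact integral_nonneg fun x => mul_nonneg (hnn x) (sq_nonneg _)

/-- For a centered log-concave probability density `f` on ℝⁿ, with
`L_μ = e^{-Ent(μ)/n} (det cov μ)^{1/(2n)}`, one has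
`L_μ ≤ f(0)^{1/n} (det cov μ)^{1/(2n)} ≤ e L_μ`. -/
theorem stmt1 (n : ℕ) (hn : 0 < n) (f : EuclideanSpace ℝ (Fin n) → ℝ)
    (hf_meas : Measurable f) (hf_nonneg : ∀ x, 0 ≤ f x)
    (hf_prob : ∫ x, f x = 1)
    (hf_logconcave : ∀ x y : EuclideanSpace ℝ (Fin n), ∀ t : ℝ, 0 ≤ t → t ≤ 1 →
      f x ^ t * f y ^ (1 - t) ≤ f (t • x + (1 - t) • y))
    (hf_centered : ∫ x, f x • x = 0) :
    let Ent : ℝ := -∫ x, f x * Real.log (f x)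
    let cov : Matrix (Fin n) (Fin n) ℝ := Matrix.of fun i j =>
      (∫ x : EuclideanSpace ℝ (Fin n), f x * (x i * x j)) -
        (∫ x : EuclideanSpace ℝ (Fin n), f x * x i) *
          (∫ x : EuclideanSpace ℝ (Fin n), f x * x j)
    let L : ℝ := Real.exp (-Ent / n) * cov.det ^ (1 / (2 * (n : ℝ)))
    L ≤ f 0 ^ (1 / (n : ℝ)) * cov.det ^ (1 / (2 * (n : ℝ))) ∧
      f 0 ^ (1 / (n : ℝ)) * cov.det ^ (1 / (2 * (n : ℝ))) ≤ Real.exp 1 * L := by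
  intro Ent cov L
  have hlc : IsLogConcave f := hf_logconcave
  have hint : Integrable f := integrable_of_integral_eq_one hf_prob
  have h0 := hlc.zero_mem_interior_support hf_meas hf_nonneg hint (by simp [hf_prob]) hf_centered
  have hf0 : 0 < f 0 := interior_subset (s := {x | 0 < f x}) h0
  have hlower := hlc.integral_mul_log_le hf_meas hf_nonneg hint hf_prob hf_centered
  have hupper := hlc.log_sub_finrank_le_integral_mul_log hf_meas hf_nonneg hint hf_prob h0
  rw [finrank_euclideanSpace_fin] at hupper
  have hid := hlc.integrable_smul_id hf_meas hf_nonneg hint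
  have hmean : ∀ i, ∫ x : EuclideanSpace ℝ (Fin n), f x * x i = 0 := by
    intro i
    have := (EuclideanSpace.proj (𝕜 := ℝ) i).integral_comp_comm hid
    simpa [hf_centered] using this
  have hdet : 0 ≤ cov.det := by
    have hcov : cov = Matrix.of fun i j => ∫ x : EuclideanSpace ℝ (Fin n), f x * (x i * x j) := by
      ext i j
      simp [cov, hmean]
    rw [hcov]
    exact (posSemidef_secondMoment hf_meas hf_nonneg
      (hlc.integrable_norm_sq_mul hf_meas hf_nonneg hint)).det_nonneg
  have hdetpow : 0 ≤ cov.det ^ (1 / (2 * (n : ℝ))) := Real.rpow_nonneg hdet _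
  have hn' : (0 : ℝ) < n := by exact_mod_cast hn
  have hEnt : -Ent = ∫ x, f x * Real.log (f x) := neg_neg _
  have hrpow : f 0 ^ (1 / (n : ℝ)) = Real.exp (Real.log (f 0) / n) := by
    rw [Real.rpow_def_of_pos hf0, mul_one_div]
  refine ⟨mul_le_mul_of_nonneg_right ?_ hdetpow, ?_⟩
  · rw [hrpow, hEnt]
    exact Real.exp_le_exp.2 (by gcongr)
  · rw [← mul_assoc]
    refine mul_le_mul_of_nonneg_right ?_ hdetpow
    rw [hrpow, ← Real.exp_add, hEnt, Real.exp_le_exp, ← sub_le_iff_le_add', div_sub_one hn'.ne']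
    gcongr
end

section
/- Let X^{(1)}, X^{(2)} be independent random vectors with the same centered log-concave law μ on ℝⁿ with density f. Then Ent((X^{(1)}+X^{(2)})/√2) - Ent(X^{(1)}) ≤ 2n. -/
open MeasureTheory ProbabilityTheory

namespace LogConcaveEntropy

section Midpoint

variable {E : Type*} [NormedAddCommGroup E] [NormedSpace ℝ E] [FiniteDimensional ℝ E]
  [MeasurableSpace E] [BorelSpace E] {m : Measure E} [m.IsAddHaarMeasure] {f : E → ℝ}

/-- The square root of an integrable midpoint log-concave function is integrable. -/
lemma integrable_sqrt (hmeas : Measurable f) (hint : Integrable f m)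
    (hmid : ∀ x y, √(f x) * √(f y) ≤ f ((1 / 2 : ℝ) • (x + y))) {a : E} (ha : 0 < f a) :
    Integrable (fun x => √(f x)) m := by
  have hdom : Integrable (fun x => f ((1 / 2 : ℝ) • (x + a)) / √(f a)) m :=
    ((hint.comp_smul (by norm_num : (1 / 2 : ℝ) ≠ 0)).comp_add_right a).div_const _
  refine hdom.mono' hmeas.sqrt.aestronglyMeasurable (.of_forall fun x => ?_)
  rw [Real.norm_of_nonneg (Real.sqrt_nonneg _), le_div_iff₀ (Real.sqrt_pos.2 ha)]
  exact hmid x a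

/-- An integrable midpoint log-concave function is bounded above. -/
lemma exists_forall_le (hmeas : Measurable f) (hnonneg : ∀ x, 0 ≤ f x) (hint : Integrable f m)
    (hpos : 0 < ∫ x, f x ∂m)
    (hmid : ∀ x y, √(f x) * √(f y) ≤ f ((1 / 2 : ℝ) • (x + y))) {a : E} (ha : 0 < f a) :
    ∃ M, ∀ x, f x ≤ M := by
  have hsqrt := integrable_sqrt hmeas hint hmid ha
  have hI : 0 < ∫ y, √(f y) ∂m := by
    rw [integral_pos_iff_support_of_nonneg (fun x => Real.sqrt_nonneg _) hsqrt]
    have hsupp : Function.support (fun x => √(f x)) = Function.support f := by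
      ext x
      simp [Real.sqrt_eq_zero (hnonneg x)]
    rwa [hsupp, ← integral_pos_iff_support_of_nonneg hnonneg hint]
  set K : ℝ := ∫ y, f ((1 / 2 : ℝ) • y) ∂m
  have hle : ∀ x, √(f x) ≤ K / ∫ y, √(f y) ∂m := fun x => by
    have hcomp : Integrable (fun y => f ((1 / 2 : ℝ) • (x + y))) m :=
      (hint.comp_smul (by norm_num : (1 / 2 : ℝ) ≠ 0)).comp_add_left x
    rw [le_div_iff₀ hI, ← integral_const_mul]
    calc ∫ y, √(f x) * √(f y) ∂m ≤ ∫ y, f ((1 / 2 : ℝ) • (x + y)) ∂m :=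
          integral_mono (hsqrt.const_mul _) hcomp fun y => hmid x y
      _ = K := integral_add_left_eq_self (fun y => f ((1 / 2 : ℝ) • y)) x
  refine ⟨(K / ∫ y, √(f y) ∂m) ^ 2, fun x => ?_⟩
  rw [← Real.sq_sqrt (hnonneg x)]
  exact pow_le_pow_left₀ (Real.sqrt_nonneg _) (hle x) 2

end Midpoint

/-- A bound on `t log t` that is integrable along densities with integrable square root. -/
lemma abs_mul_log_le {t M : ℝ} (ht : 0 ≤ t) (htM : t ≤ M) :
    |t * Real.log t| ≤ 2 * √t + t * |Real.log M| := by
  rcases ht.eq_or_lt with rfl | ht0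
  · simp
  rcases le_total t 1 with h1 | h1
  · have hs := Real.sqrt_pos.2 ht0
    have hlog := (Real.abs_log_mul_self_lt (√t) hs (Real.sqrt_le_one.2 h1)).le
    have heq : t * Real.log t = 2 * √t * (Real.log (√t) * √t) := by
      rw [Real.log_sqrt ht]
      nth_rewrite 1 [← Real.mul_self_sqrt ht]
      ring
    rw [heq, abs_mul, abs_of_pos (by positivity : 0 < 2 * √t)]
    nlinarith [mul_nonneg ht (abs_nonneg (Real.log M))]
  · rw [abs_mul, abs_of_pos ht0, abs_of_nonneg (Real.log_nonneg h1)]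
    have hlog := (Real.log_le_log ht0 htM).trans (le_abs_self _)
    nlinarith [Real.sqrt_nonneg t]

lemma mul_log_le_mul_log_add {t h : ℝ} (ht : 0 ≤ t) (hh : 0 ≤ h) (hth : t ≠ 0 → 0 < h) :
    t * Real.log h ≤ t * Real.log t + (h - t) := by
  rcases ht.eq_or_lt with rfl | ht0
  · simpa using hh
  have hh0 := hth ht0.ne'
  have hlog := Real.log_le_sub_one_of_pos (div_pos hh0 ht0)
  rw [Real.log_div hh0.ne' ht0.ne'] at hlog
  have hmul := mul_le_mul_of_nonneg_left hlog ht
  have heq : t * (h / t - 1) = h - t := by field_simp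
  linarith

/-- The **Gibbs inequality** for a bounded density `p`. -/
lemma integral_mul_log_le {α : Type*} [MeasurableSpace α] {m : Measure α} {p q : α → ℝ} {C : ℝ}
    (hpm : Measurable p) (hp : ∀ x, 0 ≤ p x) (hq : ∀ x, 0 ≤ q x)
    (hpi : Integrable p m) (hqi : Integrable q m) (hpq : ∫ x, q x ∂m ≤ ∫ x, p x ∂m)
    (hpos : ∀ᵐ x ∂m, p x ≠ 0 → 0 < q x) (hlog : Integrable (fun x => p x * Real.log (q x)) m)
    (hC : ∀ᵐ x ∂m, p x ≤ C) :
    ∫ x, p x * Real.log (q x) ∂m ≤ ∫ x, p x * Real.log (p x) ∂m := by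
  have hle : ∀ᵐ x ∂m, p x * Real.log (q x) ≤ p x * Real.log (p x) + (q x - p x) := by
    filter_upwards [hpos] with x hx using mul_log_le_mul_log_add (hp x) (hq x) hx
  have hent : Integrable (fun x => p x * Real.log (p x)) m := by
    refine integrable_of_le_of_le (hpm.mul hpm.log).aestronglyMeasurable ?_ ?_
      (hlog.sub (hqi.sub hpi)) (hpi.mul_const (Real.log C))
    · filter_upwards [hle] with x hx
      simp only [Pi.sub_apply]
      linarith
    · filter_upwards [hC] with x hx
      rcases (hp x).eq_or_lt with h0 | h0
      · simp [← h0]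
      · exact mul_le_mul_of_nonneg_left (Real.log_le_log h0 hx) h0.le
  have hmono := integral_mono_ae hlog (hent.add (hqi.sub hpi)) hle
  rw [integral_add' hent (hqi.sub hpi), integral_sub' hqi hpi] at hmono
  linarith

/-- Convolution with a probability measure preserves domination by a multiple of an invariant
measure. -/
lemma conv_le_smul {E : Type*} [AddCommGroup E] [MeasurableSpace E] [MeasurableAdd₂ E]
    {m μ ρ : Measure E} [SigmaFinite m] [m.IsAddRightInvariant] [SFinite μ]
    [IsProbabilityMeasure ρ] {c : NNReal} (h : μ ≤ c • m) : μ ∗ ρ ≤ c • m := by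
  have hm : m ∗ ρ = m := by
    have hfst : Measure.map Prod.fst (m.prod ρ) = m := by simp [Measure.map_fst_prod]
    conv_rhs => rw [← hfst, ← (measurePreserving_add_prod m ρ).map_eq,
      Measure.map_map measurable_fst (by fun_prop)]
    rfl
  calc μ ∗ ρ ≤ (c • m) ∗ ρ := Measure.map_mono (Measure.prod_mono h le_rfl) (by fun_prop)
    _ = c • m := by
      change ((c : ENNReal) • m) ∗ ρ = (c : ENNReal) • m
      rw [Measure.conv_smul_left, hm]

/-- A measure dominated by a multiple of `m` has bounded density. -/
lemma rnDeriv_toReal_le {α : Type*} [MeasurableSpace α] {m ν : Measure α} [SigmaFinite m]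
    {c : NNReal} (h : ν ≤ c • m) : ∀ᵐ x ∂m, (ν.rnDeriv m x).toReal ≤ c := by
  have hle : ν.rnDeriv m ≤ᵐ[m] fun _ => (c : ENNReal) := by
    refine ae_le_of_forall_setLIntegral_le_of_sigmaFinite (Measure.measurable_rnDeriv ν m)
      fun s _ _ => ?_
    rw [setLIntegral_const]
    exact (Measure.setLIntegral_rnDeriv_le s).trans (h s)
  filter_upwards [hle] with x hx
  exact ENNReal.toReal_le_coe_of_le_coe hx

end LogConcaveEntropy

/-- Ball–Nguyen bound: if `X₁, X₂` are independent with the same centered log-concave law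
`μ` on ℝⁿ (density `f`), then `Ent((X₁+X₂)/√2) - Ent(X₁) ≤ 2n`. -/
theorem stmt15 (n : ℕ) {Ω : Type*} {mΩ : MeasurableSpace Ω} (P : Measure Ω)
    [IsProbabilityMeasure P]
    (f : EuclideanSpace ℝ (Fin n) → ℝ)
    (hf_meas : Measurable f) (hf_nonneg : ∀ x, 0 ≤ f x)
    (hf_prob : ∫ x, f x = 1)
    (hf_logconcave : ∀ x y : EuclideanSpace ℝ (Fin n), ∀ t : ℝ, 0 ≤ t → t ≤ 1 →
      f x ^ t * f y ^ (1 - t) ≤ f (t • x + (1 - t) • y))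
    (hf_centered : ∫ x, f x • x = 0)
    (X₁ X₂ : Ω → EuclideanSpace ℝ (Fin n)) (h1 : Measurable X₁) (h2 : Measurable X₂)
    (hindep : IndepFun X₁ X₂ P)
    (hlaw1 : Measure.map X₁ P = volume.withDensity fun x => ENNReal.ofReal (f x))
    (hlaw2 : Measure.map X₂ P = volume.withDensity fun x => ENNReal.ofReal (f x)) :
    let ν : Measure (EuclideanSpace ℝ (Fin n)) :=
      Measure.map (fun ω => (Real.sqrt 2)⁻¹ • (X₁ ω + X₂ ω)) P
    (-∫ x, (ν.rnDeriv volume x).toReal * Real.log ((ν.rnDeriv volume x).toReal))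
        - (-∫ x, f x * Real.log (f x)) ≤ 2 * n := by

  intro ν
  set s : ℝ := (√2)⁻¹ with hs_def
  have hs : 0 < s := by positivity
  have hss : s * s = 1 / 2 := by
    rw [hs_def, ← mul_inv, Real.mul_self_sqrt zero_le_two, one_div]
  have hmid : ∀ x y, √(f x) * √(f y) ≤ f ((1 / 2 : ℝ) • (x + y)) := fun x y => by
    have h := hf_logconcave x y (1 / 2) (by norm_num) (by norm_num)
    rw [show (1 : ℝ) - 1 / 2 = 1 / 2 by norm_num, ← smul_add] at h
    simpa only [Real.sqrt_eq_rpow] using h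
  have hf_int : Integrable f := .of_integral_ne_zero (by simp [hf_prob])
  obtain ⟨a, ha⟩ : ∃ a, 0 < f a := by
    by_contra! h
    have h0 : f = 0 := funext fun x => le_antisymm (h x) (hf_nonneg x)
    simp [h0] at hf_prob
  have hsqrt := LogConcaveEntropy.integrable_sqrt hf_meas hf_int hmid ha
  obtain ⟨M, hfM⟩ := LogConcaveEntropy.exists_forall_le hf_meas hf_nonneg hf_int
    (by simp [hf_prob]) hmid ha
  have hent : Integrable fun x => f x * Real.log (f x) :=
    ((hsqrt.const_mul 2).add (hf_int.mul_const |Real.log M|)).mono'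
      (hf_meas.mul hf_meas.log).aestronglyMeasurable
      (.of_forall fun x => LogConcaveEntropy.abs_mul_log_le (hf_nonneg x) (hfM x))
  have hof : Measurable fun x => ENNReal.ofReal (f x) := hf_meas.ennreal_ofReal
  have hfin : ∀ᵐ x ∂(volume : Measure (EuclideanSpace ℝ (Fin n))), ENNReal.ofReal (f x) < ⊤ :=
    .of_forall fun _ => ENNReal.ofReal_lt_top
  -- Facts about each summand that depend only on its law.
  have hlogX : ∀ X : Ω → EuclideanSpace ℝ (Fin n), Measurable X →
      Measure.map X P = volume.withDensity (fun x => ENNReal.ofReal (f x)) →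
      (∀ᵐ ω ∂P, 0 < f (X ω)) ∧ Integrable (fun ω => Real.log (f (X ω))) P ∧
        ∫ ω, Real.log (f (X ω)) ∂P = ∫ x, f x * Real.log (f x) := fun X hX hlaw => by
    refine ⟨?_, ?_, ?_⟩
    · refine ae_of_ae_map hX.aemeasurable (p := fun x => 0 < f x) ?_
      rw [hlaw, ae_withDensity_iff hof]
      exact .of_forall fun x hx => by simpa using hx
    · refine Integrable.comp_measurable (g := fun x => Real.log (f x)) ?_ hX
      rw [hlaw, integrable_withDensity_iff_integrable_smul' hof hfin]
      simpa only [ENNReal.toReal_ofReal (hf_nonneg _), smul_eq_mul] using hent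
    · rw [← integral_map (f := fun x => Real.log (f x)) hX.aemeasurable
        hf_meas.log.aestronglyMeasurable, hlaw,
        integral_withDensity_eq_integral_toReal_smul hof hfin]
      simp only [ENNReal.toReal_ofReal (hf_nonneg _), smul_eq_mul]
  obtain ⟨hpos1, hint1, heq1⟩ := hlogX X₁ h1 hlaw1
  obtain ⟨hpos2, hint2, heq2⟩ := hlogX X₂ h2 hlaw2
  have hYm : Measurable fun ω => s • (X₁ ω + X₂ ω) := (h1.add h2).const_smul s
  have : IsProbabilityMeasure ν := Measure.isProbabilityMeasure_map hYm.aemeasurable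
  obtain ⟨c, hc⟩ : ∃ c : NNReal, ν ≤ c • volume := by
    have : IsProbabilityMeasure (Measure.map X₁ P) :=
      Measure.isProbabilityMeasure_map h1.aemeasurable
    have : IsProbabilityMeasure (Measure.map X₂ P) :=
      Measure.isProbabilityMeasure_map h2.aemeasurable
    have hdom : Measure.map X₁ P ≤ M.toNNReal • volume := by
      change _ ≤ (M.toNNReal : ENNReal) • volume
      rw [hlaw1, ← withDensity_const]
      exact withDensity_mono (.of_forall fun x => ENNReal.ofReal_le_ofReal (hfM x))
    refine ⟨M.toNNReal * |(s ^ Module.finrank ℝ (EuclideanSpace ℝ (Fin n)))⁻¹|.toNNReal, ?_⟩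
    have hν : ν = Measure.map (fun x => s • x) (Measure.map X₁ P ∗ Measure.map X₂ P) := by
      rw [← hindep.map_add_eq_map_conv_map h1 h2, Measure.map_map (by fun_prop) (h1.add h2)]
      rfl
    rw [hν, mul_smul]
    calc _ ≤ Measure.map (fun x => s • x) (M.toNNReal • volume) :=
          Measure.map_mono (LogConcaveEntropy.conv_le_smul hdom) (by fun_prop)
      _ = _ := by
        rw [Measure.map_smul, Measure.map_addHaar_smul volume hs.ne']
        rfl
  have hac : ν ≪ volume :=
    (Measure.absolutelyContinuous_of_le hc).trans Measure.smul_absolutelyContinuous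
  -- The comparison density in the Gibbs inequality is that of `√2 • X₁`.
  set q : EuclideanSpace ℝ (Fin n) → ℝ := fun y => s ^ n * f (s • y) with hq_def
  have hqY : ∀ ω, q (s • (X₁ ω + X₂ ω)) = s ^ n * f ((1 / 2 : ℝ) • (X₁ ω + X₂ ω)) := fun ω => by
    simp only [hq_def, smul_smul, hss]
  have hqm : Measurable q := (hf_meas.comp (measurable_const_smul s)).const_mul _
  have hq_int : Integrable q := (hf_int.comp_smul hs.ne').const_mul _
  have hq_prob : ∫ y, q y = 1 := by
    rw [integral_const_mul, Measure.integral_comp_smul, hf_prob, finrank_euclideanSpace_fin,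
      abs_of_pos (by positivity), smul_eq_mul, mul_one, mul_inv_cancel₀ (by positivity)]
  have hsn : 0 < s ^ n := by positivity
  have hmidpos : ∀ᵐ ω ∂P, 0 < f ((1 / 2 : ℝ) • (X₁ ω + X₂ ω)) := by
    filter_upwards [hpos1, hpos2] with ω hω1 hω2
    exact (mul_pos (Real.sqrt_pos.2 hω1) (Real.sqrt_pos.2 hω2)).trans_le (hmid _ _)
  have hlow : ∀ᵐ ω ∂P, Real.log (s ^ n) +
      (Real.log (f (X₁ ω)) / 2 + Real.log (f (X₂ ω)) / 2) ≤
        Real.log (q (s • (X₁ ω + X₂ ω))) := by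
    filter_upwards [hpos1, hpos2, hmidpos] with ω hω1 hω2 hω
    have hx1 := Real.sqrt_pos.2 hω1
    have hx2 := Real.sqrt_pos.2 hω2
    have hlog := Real.log_le_log (mul_pos hx1 hx2) (hmid (X₁ ω) (X₂ ω))
    rw [Real.log_mul hx1.ne' hx2.ne', Real.log_sqrt hω1.le, Real.log_sqrt hω2.le] at hlog
    rw [hqY, Real.log_mul hsn.ne' hω.ne']
    linarith
  have hmean_int : Integrable (fun ω =>
      Real.log (f (X₁ ω)) / 2 + Real.log (f (X₂ ω)) / 2) P :=
    (hint1.div_const 2).add (hint2.div_const 2)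
  have hlow_int : Integrable (fun ω => Real.log (s ^ n) +
      (Real.log (f (X₁ ω)) / 2 + Real.log (f (X₂ ω)) / 2)) P :=
    (integrable_const _).add hmean_int
  have hlogqY : Integrable (fun ω => Real.log (q (s • (X₁ ω + X₂ ω)))) P := by
    refine integrable_of_le_of_le (hqm.log.comp hYm).aestronglyMeasurable hlow ?_ hlow_int
      (integrable_const (Real.log (s ^ n * M)))
    filter_upwards [hmidpos] with ω hω
    rw [hqY]
    exact Real.log_le_log (mul_pos hsn hω) (mul_le_mul_of_nonneg_left (hfM _) hsn.le)
  have hlogq : Integrable (fun y => Real.log (q y)) ν :=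
    (integrable_map_measure hqm.log.aestronglyMeasurable hYm.aemeasurable).2 hlogqY
  have hqpos : ∀ᵐ y, (ν.rnDeriv volume y).toReal ≠ 0 → 0 < q y := by
    have hν : ∀ᵐ y ∂ν, 0 < q y := by
      refine (ae_map_iff hYm.aemeasurable (measurableSet_lt measurable_const hqm)).2 ?_
      filter_upwards [hmidpos] with ω hω
      rw [hqY]
      exact mul_pos hsn hω
    rw [← Measure.withDensity_rnDeriv_eq ν volume hac,
      ae_withDensity_iff (Measure.measurable_rnDeriv ν volume)] at hν
    filter_upwards [hν] with y hy h0
    exact hy fun h => h0 (by simp [h])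
  have hgibbs := LogConcaveEntropy.integral_mul_log_le
    (Measure.measurable_rnDeriv ν volume).ennreal_toReal (fun _ => ENNReal.toReal_nonneg)
    (fun y => mul_nonneg hsn.le (hf_nonneg _)) Measure.integrable_toReal_rnDeriv hq_int
    (by rw [hq_prob, Measure.integral_toReal_rnDeriv hac]; simp) hqpos
    ((integrable_rnDeriv_smul_iff hac).2 hlogq) (LogConcaveEntropy.rnDeriv_toReal_le hc)
  have hcross : Real.log (s ^ n) + ∫ x, f x * Real.log (f x) ≤
      ∫ y, (ν.rnDeriv volume y).toReal * Real.log (q y) := by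
    calc Real.log (s ^ n) + ∫ x, f x * Real.log (f x)
        = ∫ ω, (Real.log (s ^ n) +
            (Real.log (f (X₁ ω)) / 2 + Real.log (f (X₂ ω)) / 2)) ∂P := by
          rw [integral_add (integrable_const _) hmean_int,
            integral_add (hint1.div_const 2) (hint2.div_const 2), integral_div, integral_div,
            heq1, heq2]
          simp
      _ ≤ ∫ ω, Real.log (q (s • (X₁ ω + X₂ ω))) ∂P := integral_mono_ae hlow_int hlogqY hlow
      _ = ∫ y, Real.log (q y) ∂ν :=
          (integral_map hYm.aemeasurable hqm.log.aestronglyMeasurable).symm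
      _ = ∫ y, (ν.rnDeriv volume y).toReal * Real.log (q y) := (integral_rnDeriv_smul hac).symm
  have hlogs : -(n : ℝ) ≤ Real.log (s ^ n) := by
    have hlog2 : Real.log s = -(Real.log 2 / 2) := by
      rw [hs_def, Real.log_inv, Real.log_sqrt zero_le_two]
    rw [Real.log_pow, hlog2]
    nlinarith [Real.log_two_lt_d9, (Nat.cast_nonneg n : (0 : ℝ) ≤ n)]
  have hn : (0 : ℝ) ≤ n := n.cast_nonneg
  linarith
end
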